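/- Let K^w_E ⊆ ℝ^m be a generating isotonic regression cone whose defining half-space representation is irredundant. If K^w_E is an isotonic projection cone, then in the directed graph (V, E) every vertex is the tail of at most one edge and the head of at most one edge; consequently (V, E) splits into a disjoint union of connected simple directed graphs in which each vertex is the tail of at most one edge and the head of at most one edge. -/

import Mathlib

open scoped RealInnerProductSpace

/-- For an edge `p = (i, j)`, the normal vector `a_{ij} ∈ ℝ^m` with `i`-th coordinate
`1/√(w^i)`, `j`-th coordinate `-1/√(w^j)`, and all other coordinates `0`. -/
noncomputable def edgeNormal {m : ℕ} (w : Fin m → ℝ) (p : Fin m × Fin m) :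
    EuclideanSpace ℝ (Fin m) :=
  (Real.sqrt (w p.1))⁻¹ • EuclideanSpace.single p.1 (1 : ℝ) -
    (Real.sqrt (w p.2))⁻¹ • EuclideanSpace.single p.2 (1 : ℝ)

/-- A vertex `u` is incident to some edge of the edge set `S`. -/
def Touches {m : ℕ} (S : Set (Fin m × Fin m)) (u : Fin m) : Prop :=
  ∃ v, (u, v) ∈ S ∨ (v, u) ∈ S

section PolyhedralCone

variable {κ H : Type*} [NormedAddCommGroup H] [InnerProductSpace ℝ H]

/-- A generating cone cut out by finitely many nonzero normals has a point that is strictly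
inside all the half-spaces. -/
theorem exists_forall_inner_neg_of_generating {E : Set κ} (hE : E.Finite) {a : κ → H}
    (ha : ∀ p ∈ E, a p ≠ 0)
    (hgen : ∀ z : H, ∃ x y : H, (∀ p ∈ E, ⟪a p, x⟫ ≤ 0) ∧ (∀ p ∈ E, ⟪a p, y⟫ ≤ 0) ∧ z = x - y) :
    ∃ c : H, ∀ p ∈ E, ⟪a p, c⟫ < 0 := by
  choose x y hx hy hz using fun p => hgen (a p)
  refine ⟨∑ r ∈ hE.toFinset, y r, fun p hp => ?_⟩
  rw [inner_sum]
  refine Finset.sum_neg' (fun r _ => hy r p hp) ⟨p, hE.mem_toFinset.2 hp, ?_⟩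
  have hpos : 0 < ⟪a p, a p⟫ := real_inner_self_pos.2 (ha p hp)
  have hsub : ⟪a p, a p⟫ = ⟪a p, x p⟫ - ⟪a p, y p⟫ := by rw [← inner_sub_right, ← hz p]
  linarith [hx p p hp]

/-- An irredundant half-space supports the cone in a point that is strictly inside all the other
half-spaces. -/
theorem exists_relint_facet {E : Set κ} {a : κ → H} {p : κ} {c : H}
    (hc : ∀ r ∈ E, ⟪a r, c⟫ < 0) (hp : p ∈ E)
    (hirr : ¬ ((⋂ q ∈ E \ {p}, {x : H | ⟪a q, x⟫ ≤ 0}) ⊆ {x : H | ⟪a p, x⟫ ≤ 0})) :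
    ∃ x : H, ⟪a p, x⟫ = 0 ∧ ∀ r ∈ E, r ≠ p → ⟪a r, x⟫ < 0 := by
  obtain ⟨z, hz, hzp⟩ := Set.not_subset.1 hirr
  simp only [Set.mem_iInter, Set.mem_ofPred_eq, Set.mem_sdiff, Set.mem_singleton_iff] at hz hzp
  have hcp := hc p hp
  have ht : 0 < -⟪a p, z⟫ / ⟪a p, c⟫ := div_pos_of_neg_of_neg (by linarith) hcp
  refine ⟨z + (-⟪a p, z⟫ / ⟪a p, c⟫) • c, ?_, fun r hr hrp => ?_⟩
  · rw [inner_add_right, real_inner_smul_right, div_mul_cancel₀ _ hcp.ne]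
    ring
  · rw [inner_add_right, real_inner_smul_right]
    linarith [hz r ⟨hr, hrp⟩, mul_neg_of_pos_of_neg ht (hc r hr)]

/-- Strict linear inequalities survive a small perturbation. -/
theorem exists_pos_forall_inner_add_smul_neg {E : Set κ} (hE : E.Finite) {a : κ → H} {x : H}
    (hx : ∀ r ∈ E, ⟪a r, x⟫ < 0) (v : H) :
    ∃ s : ℝ, 0 < s ∧ ∀ r ∈ E, ⟪a r, x + s • v⟫ < 0 := by
  have h : ∀ᶠ s : ℝ in nhdsWithin 0 (Set.Ioi 0), ∀ r ∈ E, ⟪a r, x + s • v⟫ < 0 := by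
    refine (hE.eventually_all).2 fun r hr => ?_
    have hcont : Continuous fun s : ℝ => ⟪a r, x + s • v⟫ := by fun_prop
    exact nhdsWithin_le_nhds
      (hcont.continuousAt.eventually_lt continuousAt_const (by simpa using hx r hr))
  obtain ⟨s, hs, hpos⟩ := (h.and self_mem_nhdsWithin).exists
  exact ⟨s, hpos, hs⟩

/-- If the metric projection onto a generating polyhedral cone is isotonic, then the normals of two
distinct irredundant half-spaces form a non-acute angle. -/
theorem inner_nonpos_of_isotonic_projection {E : Set κ} (hE : E.Finite) {a : κ → H}
    (ha : ∀ p ∈ E, a p ≠ 0) {K : Set H} (hK : K = ⋂ p ∈ E, {x | ⟪a p, x⟫ ≤ 0})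
    (hgen : ∀ z : H, ∃ x ∈ K, ∃ y ∈ K, z = x - y)
    (hirr : ∀ p ∈ E,
      ¬ ((⋂ q ∈ E \ {p}, {x : H | ⟪a q, x⟫ ≤ 0}) ⊆ {x : H | ⟪a p, x⟫ ≤ 0}))
    {P : H → H} (hP : ∀ x, P x ∈ K ∧ ∀ q ∈ K, dist x (P x) ≤ dist x q)
    (hiso : ∀ x y : H, y - x ∈ K → P y - P x ∈ K)
    {p q : κ} (hp : p ∈ E) (hq : q ∈ E) (hpq : p ≠ q) : ⟪a p, a q⟫ ≤ 0 := by
  have hmem : ∀ x, x ∈ K ↔ ∀ r ∈ E, ⟪a r, x⟫ ≤ 0 := fun x => by simp [hK]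
  obtain ⟨c, hc⟩ := exists_forall_inner_neg_of_generating hE ha fun z => by
    obtain ⟨x, hx, y, hy, h⟩ := hgen z
    exact ⟨x, y, (hmem x).1 hx, (hmem y).1 hy, h⟩
  obtain ⟨x, hxp, hx⟩ := exists_relint_facet hc hp (hirr p hp)
  obtain ⟨k, hkq, hk⟩ := exists_relint_facet hc hq (hirr q hq)
  have hxK : x ∈ K := (hmem x).2 fun r hr => by
    by_cases h : r = p
    · exact h ▸ hxp.le
    · exact (hx r hr h).le
  have hkK : k ∈ K := (hmem k).2 fun r hr => by
    by_cases h : r = q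
    · exact h ▸ hkq.le
    · exact (hk r hr h).le
  have hxk : ∀ r ∈ E, ⟪a r, x + k⟫ < 0 := fun r hr => by
    rw [inner_add_right]
    by_cases h : r = p
    · subst h
      linarith [hk r hr hpq]
    · linarith [hx r hr h, (hmem k).1 hkK r hr]
  obtain ⟨s, hs, hsneg⟩ := exists_pos_forall_inner_add_smul_neg hE hxk (a p)
  have hPx : P (x + s • a p) = x := by
    obtain ⟨hmemP, hmin⟩ := hP (x + s • a p)
    have hle := hmin x hxK
    rw [dist_eq_norm, dist_eq_norm, add_sub_cancel_left] at hle
    have hd : x + s • a p - P (x + s • a p) = s • a p - (P (x + s • a p) - x) := by abel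
    rw [hd] at hle
    set d := P (x + s • a p) - x with hd_def
    have had : ⟪a p, d⟫ ≤ 0 := by
      rw [hd_def, inner_sub_right, hxp, sub_zero]
      exact (hmem _).1 hmemP p hp
    have hsq : ‖s • a p - d‖ ^ 2 ≤ ‖s • a p‖ ^ 2 := by gcongr
    rw [norm_sub_sq_real, real_inner_smul_left] at hsq
    have : ‖d‖ ^ 2 ≤ 0 := by linarith [mul_nonpos_of_nonneg_of_nonpos hs.le had]
    have hd0 : d = 0 := norm_eq_zero.1 (pow_eq_zero_iff two_ne_zero |>.1
      (le_antisymm this (sq_nonneg _)))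
    exact sub_eq_zero.1 hd0
  have hPy : P (x + k + s • a p) = x + k + s • a p := by
    have hle := (hP (x + k + s • a p)).2 _ ((hmem _).2 fun r hr => (hsneg r hr).le)
    rw [dist_self] at hle
    exact (dist_le_zero.1 hle).symm
  have hdiff := hiso (x + s • a p) (x + k + s • a p) (by
    rwa [show x + k + s • a p - (x + s • a p) = k by abel])
  rw [hPx, hPy, show x + k + s • a p - x = k + s • a p by abel] at hdiff
  have hfin := (hmem _).1 hdiff q hq
  rw [inner_add_right, hkq, zero_add, real_inner_smul_right, real_inner_comm] at hfin
  exact nonpos_of_mul_nonpos_right hfin hs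

end PolyhedralCone

section EdgeNormal

variable {m : ℕ} {w : Fin m → ℝ}

theorem inner_edgeNormal (i j : Fin m) (x : EuclideanSpace ℝ (Fin m)) :
    ⟪edgeNormal w (i, j), x⟫ = (Real.sqrt (w i))⁻¹ * x i - (Real.sqrt (w j))⁻¹ * x j := by
  simp [edgeNormal, inner_sub_left, real_inner_smul_left, EuclideanSpace.inner_single_left]

theorem edgeNormal_apply (i j k : Fin m) :
    edgeNormal w (i, j) k =
      (Real.sqrt (w i))⁻¹ * (if k = i then 1 else 0) -
        (Real.sqrt (w j))⁻¹ * (if k = j then 1 else 0) := by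
  simp [edgeNormal]

theorem edgeNormal_ne_zero (hw : ∀ i, 0 < w i) {p : Fin m × Fin m} (hp : p.1 ≠ p.2) :
    edgeNormal w p ≠ 0 := by
  intro h
  have h1 : edgeNormal w (p.1, p.2) p.1 = 0 := by rw [Prod.mk.eta, h]; rfl
  rw [edgeNormal_apply] at h1
  simp [hp, (Real.sqrt_pos.2 (hw p.1)).ne'] at h1

theorem inner_edgeNormal_pos_of_common_tail (hw : ∀ i, 0 < w i) {i j k : Fin m}
    (hij : i ≠ j) (hik : i ≠ k) (hjk : j ≠ k) :
    0 < ⟪edgeNormal w (i, j), edgeNormal w (i, k)⟫ := by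
  have := Real.sqrt_pos.2 (hw i)
  simp only [inner_edgeNormal, edgeNormal_apply, if_neg hik, if_neg hij.symm, if_neg hjk]
  simp only [if_true, mul_zero, sub_zero, mul_one]
  positivity

theorem inner_edgeNormal_pos_of_common_head (hw : ∀ i, 0 < w i) {i j k : Fin m}
    (hij : i ≠ j) (hkj : k ≠ j) (hik : i ≠ k) :
    0 < ⟪edgeNormal w (i, j), edgeNormal w (k, j)⟫ := by
  have := Real.sqrt_pos.2 (hw j)
  simp only [inner_edgeNormal, edgeNormal_apply, if_neg hik, if_neg hij, if_neg hkj.symm]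
  simp only [if_true, mul_zero, zero_sub, sub_zero, mul_one, mul_neg, neg_neg]
  positivity

end EdgeNormal

/-- The edge set of a directed graph is the disjoint union of the edge sets of its weakly connected
components. -/
theorem exists_connected_decomposition {m : ℕ} (E : Set (Fin m × Fin m)) :
    ∃ (ι : Type) (comp : ι → Set (Fin m × Fin m)),
      Pairwise (Function.onFun Disjoint comp) ∧ (⋃ c, comp c) = E ∧
      ∀ c u v, Touches (comp c) u → Touches (comp c) v →
        Relation.ReflTransGen (fun i j => (i, j) ∈ comp c ∨ (j, i) ∈ comp c) u v := by
  let A : Fin m → Fin m → Prop := fun i j => (i, j) ∈ E ∨ (j, i) ∈ E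
  have hA : Std.Symm A := ⟨fun _ _ h => h.symm⟩
  let S : Setoid (Fin m) :=
    ⟨Relation.ReflTransGen A, fun _ => .refl, fun h => Std.Symm.symm _ _ h, .trans⟩
  let comp : Quotient S → Set (Fin m × Fin m) := fun c => {p | p ∈ E ∧ Quotient.mk S p.1 = c}
  have hadj : ∀ {u v}, A u v → Quotient.mk S u = Quotient.mk S v :=
    fun h => Quotient.sound (Relation.ReflTransGen.single h)
  have htouch : ∀ {c u}, Touches (comp c) u → Quotient.mk S u = c := by
    rintro c u ⟨v, h | h⟩
    · exact h.2
    · exact (hadj (Or.inr h.1)).trans h.2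
  refine ⟨Quotient S, comp, ?_, ?_, ?_⟩
  · intro c d hcd
    exact Set.disjoint_left.2 fun p hc hd => hcd (hc.2.symm.trans hd.2)
  · ext p
    simp [comp]
  · intro c u v hu hv
    have huc := htouch hu
    have huv : Relation.ReflTransGen A u v := Quotient.exact (huc.trans (htouch hv).symm)
    clear hv
    induction huv with
    | refl => exact .refl
    | @tail b d hub hbd ih =>
      have hb : Quotient.mk S b = c := (Quotient.sound (s := S) hub).symm.trans huc
      refine ih.tail (hbd.imp (fun h => ⟨h, hb⟩) fun h => ⟨h, ?_⟩)
      exact (hadj (Or.inl h)).trans hb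

/-- Let `K^w_E` be a generating isotonic regression cone whose defining
half-space representation is irredundant. If `K^w_E` is an isotonic projection cone, then
in `(V, E)` every vertex is the tail of at most one edge and the head of at most one edge;
consequently `(V, E)` splits into a disjoint union of connected simple directed graphs in
which each vertex is the tail of at most one edge and the head of at most one edge. -/
theorem stmt_7 {m : ℕ} (w : Fin m → ℝ) (hw : ∀ i, 0 < w i)
    (E : Set (Fin m × Fin m)) (hloop : ∀ p ∈ E, p.1 ≠ p.2)
    (K : Set (EuclideanSpace ℝ (Fin m)))
    (hK : K = {x | ∀ p ∈ E, x p.1 / Real.sqrt (w p.1) ≤ x p.2 / Real.sqrt (w p.2)})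
    (hgen : ∀ z : EuclideanSpace ℝ (Fin m), ∃ x ∈ K, ∃ y ∈ K, z = x - y)
    (hRep : K = ⋂ p ∈ E, {x | ⟪edgeNormal w p, x⟫ ≤ 0})
    (hirr : ∀ p ∈ E,
      ¬ ((⋂ q ∈ E \ {p}, {x : EuclideanSpace ℝ (Fin m) | ⟪edgeNormal w q, x⟫ ≤ 0}) ⊆
        {x : EuclideanSpace ℝ (Fin m) | ⟪edgeNormal w p, x⟫ ≤ 0}))
    (P : EuclideanSpace ℝ (Fin m) → EuclideanSpace ℝ (Fin m))
    (hP : ∀ x, P x ∈ K ∧ ∀ q ∈ K, dist x (P x) ≤ dist x q)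
    (hiso : ∀ x y : EuclideanSpace ℝ (Fin m), y - x ∈ K → P y - P x ∈ K) :
    ((∀ i j k : Fin m, (i, j) ∈ E → (i, k) ∈ E → j = k) ∧
     (∀ i j k : Fin m, (i, j) ∈ E → (k, j) ∈ E → i = k)) ∧
    ∃ (ι : Type) (comp : ι → Set (Fin m × Fin m)),
      Pairwise (Function.onFun Disjoint comp) ∧
      (⋃ c, comp c) = E ∧
      ∀ c : ι,
        (∀ u v : Fin m, Touches (comp c) u → Touches (comp c) v →
          Relation.ReflTransGen (fun i j => (i, j) ∈ comp c ∨ (j, i) ∈ comp c) u v) ∧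
        (∀ i j k : Fin m, (i, j) ∈ comp c → (i, k) ∈ comp c → j = k) ∧
        (∀ i j k : Fin m, (i, j) ∈ comp c → (k, j) ∈ comp c → i = k) := by
  have hang : ∀ p ∈ E, ∀ q ∈ E, p ≠ q → ⟪edgeNormal w p, edgeNormal w q⟫ ≤ 0 :=
    fun p hp q hq hpq => inner_nonpos_of_isotonic_projection E.toFinite
      (fun r hr => edgeNormal_ne_zero hw (hloop r hr)) hRep hgen hirr hP hiso hp hq hpq
  have htail : ∀ i j k : Fin m, (i, j) ∈ E → (i, k) ∈ E → j = k := by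
    intro i j k hij hik
    by_contra hjk
    exact (inner_edgeNormal_pos_of_common_tail hw (hloop _ hij) (hloop (i, k) hik) hjk).not_ge
      (hang _ hij (i, k) hik (by simpa using hjk))
  have hhead : ∀ i j k : Fin m, (i, j) ∈ E → (k, j) ∈ E → i = k := by
    intro i j k hij hkj
    by_contra hik
    exact (inner_edgeNormal_pos_of_common_head hw (hloop _ hij) (hloop (k, j) hkj) hik).not_ge
      (hang _ hij (k, j) hkj (by simpa using hik))
  obtain ⟨ι, comp, hdisj, hunion, hconn⟩ := exists_connected_decomposition E
  have hsub : ∀ c, comp c ⊆ E := fun c => hunion ▸ Set.subset_iUnion comp c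
  exact ⟨⟨htail, hhead⟩, ι, comp, hdisj, hunion, fun c => ⟨hconn c,
    fun i j k h h' => htail i j k (hsub c h) (hsub c h'),
    fun i j k h h' => hhead i j k (hsub c h) (hsub c h')⟩⟩
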